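/- Let f : ℝⁿ → ℝ be continuously differentiable with bounded derivative and f bounded. Then for every t ≥ 0, ∫_{ℝⁿ} |f − Q_t f| dγₙ ≤ √(2t) · ∫_{ℝⁿ} |∇f| dγₙ. -/

import Mathlib

open MeasureTheory

/-- Standard Gaussian density `φ` on `ℝ`. -/
noncomputable def gaussPdf (x : ℝ) : ℝ := (Real.sqrt (2 * Real.pi))⁻¹ * Real.exp (-(x ^ 2) / 2)

/-- Standard Gaussian cumulative distribution function `Φ`. -/
noncomputable def gaussCdf (x : ℝ) : ℝ := ∫ t in Set.Iic x, gaussPdf t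

/-- Inverse of the Gaussian cdf (quantile function `Φ⁻¹`). -/
noncomputable def gaussQuantile : ℝ → ℝ := Function.invFun gaussCdf

/-- Gaussian isoperimetric profile `I_γ`: `I_γ(v) = φ(Φ⁻¹(v))` on `(0,1)`, `0` at the endpoints. -/
noncomputable def Igauss (v : ℝ) : ℝ :=
  if v = 0 ∨ v = 1 then 0 else gaussPdf (gaussQuantile v)

abbrev En (n : ℕ) := EuclideanSpace ℝ (Fin n)

/-- Standard Gaussian probability measure `γₙ` on `ℝⁿ`. -/
noncomputable def gaussE (n : ℕ) : Measure (En n) :=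
  volume.withDensity (fun x =>
    ENNReal.ofReal ((2 * Real.pi) ^ (-(n : ℝ) / 2) * Real.exp (-‖x‖ ^ 2 / 2)))

/-- Ornstein–Uhlenbeck semigroup `Q_t`. -/
noncomputable def ou (n : ℕ) (t : ℝ) (f : En n → ℝ) (x : En n) : ℝ :=
  ∫ y, f (Real.exp (-t) • x + Real.sqrt (1 - Real.exp (-2 * t)) • y) ∂(gaussE n)

open ProbabilityTheory

theorem cos_le_exp_neg_half_sq {x : ℝ} (hx0 : 0 ≤ x) (hx : x ≤ Real.pi / 2) :
    Real.cos x ≤ Real.exp (-(x ^ 2 / 2)) := by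
  have hanti : AntitoneOn (fun y : ℝ => Real.cos y * Real.exp (y ^ 2 / 2))
      (Set.Icc 0 (Real.pi / 2)) := by
    have hd : ∀ y : ℝ, HasDerivAt (fun y : ℝ => Real.cos y * Real.exp (y ^ 2 / 2))
        ((y * Real.cos y - Real.sin y) * Real.exp (y ^ 2 / 2)) y := by
      intro y
      have h := (Real.hasDerivAt_cos y).mul (((hasDerivAt_pow 2 y).div_const 2).exp)
      convert! h using 1
      push_cast
      ring
    refine antitoneOn_of_hasDerivWithinAt_nonpos (convex_Icc _ _)
      (fun y _ => (hd y).continuousAt.continuousWithinAt)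
      (fun y _ => (hd y).hasDerivWithinAt) ?_
    intro y hy
    rw [interior_Icc] at hy
    have hc : 0 < Real.cos y := Real.cos_pos_of_mem_Ioo ⟨by linarith [hy.1, Real.pi_pos], hy.2⟩
    have h := Real.le_tan hy.1.le hy.2
    rw [Real.tan_eq_sin_div_cos, le_div_iff₀ hc] at h
    exact mul_nonpos_of_nonpos_of_nonneg (by linarith) (Real.exp_pos _).le
  have h := hanti ⟨le_rfl, by positivity⟩ ⟨hx0, hx⟩ hx0
  simp only [Real.cos_zero, one_mul] at h
  rw [Real.exp_neg, ← one_div, le_div_iff₀ (Real.exp_pos _)]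
  simpa using h

theorem arccos_exp_neg_le_sqrt {t : ℝ} (ht : 0 ≤ t) :
    Real.arccos (Real.exp (-t)) ≤ Real.sqrt (2 * t) := by
  have h1 : Real.exp (-t) ≤ 1 := Real.exp_le_one_iff.2 (by linarith)
  have h := cos_le_exp_neg_half_sq (Real.arccos_nonneg (Real.exp (-t)))
    (Real.arccos_le_pi_div_two.2 (Real.exp_pos _).le)
  rw [Real.cos_arccos (by linarith [Real.exp_pos (-t)]) h1, Real.exp_le_exp] at h
  exact Real.le_sqrt_of_sq_le (by linarith)

theorem integral_gaussE (n : ℕ) (g : En n → ℂ) :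
    ∫ x, g x ∂(gaussE n) =
      ((2 * Real.pi : ℝ) : ℂ) ^ (-(n : ℂ) / 2) *
        ∫ x, Complex.exp (-(1 / 2 : ℂ) * ‖x‖ ^ 2) * g x := by
  rw [gaussE, integral_withDensity_eq_integral_toReal_smul (by fun_prop) (by simp),
    ← integral_const_mul]
  congr 1 with x
  rw [ENNReal.toReal_ofReal (by positivity), Complex.real_smul, ← mul_assoc]
  congr 1
  push_cast
  rw [Complex.ofReal_cpow (by positivity)]
  push_cast
  congr 2
  ring

instance isFiniteMeasure_gaussE (n : ℕ) : IsFiniteMeasure (gaussE n) := by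
  refine isFiniteMeasure_withDensity_ofReal ?_
  have h := (GaussianFourier.integrable_cexp_neg_mul_sq_norm_add (V := En n) (b := 1 / 2)
    (by norm_num) 0 0).norm
  refine Integrable.hasFiniteIntegral ?_
  refine (h.const_mul ((2 * Real.pi) ^ (-(n : ℝ) / 2))).congr (.of_forall fun x => ?_)
  simp only [Complex.norm_exp]
  congr 2
  simp [← Complex.ofReal_pow]
  ring

theorem gaussE_eq_stdGaussian (n : ℕ) : gaussE n = stdGaussian (En n) := by
  refine Measure.ext_of_charFun ?_
  ext s
  rw [charFun_stdGaussian, charFun_apply, integral_gaussE]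
  have h := GaussianFourier.integral_cexp_neg_mul_sq_norm_add (V := En n) (b := 1 / 2)
    (by norm_num) Complex.I s
  simp_rw [Complex.exp_add] at h
  simp_rw [real_inner_comm s, mul_comm _ Complex.I] at h ⊢
  rw [h, ← mul_assoc]
  have h2 : ((2 * Real.pi : ℝ) : ℂ) ≠ 0 := by
    exact_mod_cast (by positivity : (2 * Real.pi : ℝ) ≠ 0)
  have h3 : (Real.pi : ℂ) / (1 / 2) = ((2 * Real.pi : ℝ) : ℂ) := by push_cast; ring
  rw [h3, finrank_euclideanSpace_fin, ← Complex.cpow_add _ _ h2]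
  have h4 : -(n : ℂ) / 2 + n / 2 = 0 := by ring
  rw [h4, Complex.cpow_zero, one_mul, Complex.I_sq]
  congr 1
  ring

theorem lintegral_enorm_dual_stdGaussian_le {E : Type*} [NormedAddCommGroup E]
    [InnerProductSpace ℝ E] [FiniteDimensional ℝ E] [MeasurableSpace E] [BorelSpace E]
    (L : StrongDual ℝ E) : ∫⁻ y, ‖L y‖ₑ ∂(stdGaussian E) ≤ ‖L‖ₑ := by
  have hL : MemLp L 2 (stdGaussian E) := L.comp_memLp' IsGaussian.memLp_two_id
  have hint : Integrable (fun y => L y) (stdGaussian E) := hL.integrable (by norm_num)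
  have h1 := variance_dual_stdGaussian L
  rw [variance_eq_sub hL, integral_strongDual_stdGaussian] at h1
  have h2 := variance_nonneg (fun y => ‖L y‖) (stdGaussian E)
  rw [variance_eq_sub hL.norm] at h2
  simp only [Pi.pow_apply, Real.norm_eq_abs, sq_abs] at h1 h2
  have h3 : ∫ y, ‖L y‖ ∂(stdGaussian E) ≤ ‖L‖ := by
    refine le_of_sq_le_sq ?_ (norm_nonneg _)
    simp only [Real.norm_eq_abs]
    linarith
  rw [← ofReal_integral_norm_eq_lintegral_enorm hint, ← ofReal_norm]
  exact ENNReal.ofReal_le_ofReal h3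

/-- `L¹` bound on the increment of `f` along a rotation of two independent Gaussian vectors. -/
theorem lintegral_enorm_sub_rotation_le {E : Type*} [NormedAddCommGroup E]
    [InnerProductSpace ℝ E] [FiniteDimensional ℝ E] [MeasurableSpace E] [BorelSpace E]
    {f : E → ℝ} (hf : ContDiff ℝ 1 f) {θ : ℝ} (hθ : 0 ≤ θ) :
    ∫⁻ x, ∫⁻ y, ‖f x - f (Real.cos θ • x + Real.sin θ • y)‖ₑ ∂(stdGaussian E) ∂(stdGaussian E) ≤
      ENNReal.ofReal θ * ∫⁻ x, ‖fderiv ℝ f x‖ₑ ∂(stdGaussian E) := by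
  set μ := stdGaussian E with hμ
  have hfc : Continuous f := hf.continuous
  have hf' : Continuous (fderiv ℝ f) := hf.continuous_fderiv one_ne_zero
  have hpath : ∀ x y : E, ‖f x - f (Real.cos θ • x + Real.sin θ • y)‖ₑ ≤
      ∫⁻ s in Set.Ioc 0 θ, ‖fderiv ℝ f (Real.cos s • x + Real.sin s • y)
        (-Real.sin s • x + Real.cos s • y)‖ₑ := by
    intro x y
    have hd : ∀ s : ℝ, HasDerivAt (fun s : ℝ => f (Real.cos s • x + Real.sin s • y))
        (fderiv ℝ f (Real.cos s • x + Real.sin s • y)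
          (-Real.sin s • x + Real.cos s • y)) s := by
      intro s
      exact ((hf.differentiable one_ne_zero) _).hasFDerivAt.comp_hasDerivAt s
        (((Real.hasDerivAt_cos s).smul_const x).add ((Real.hasDerivAt_sin s).smul_const y))
    have hcont : Continuous fun s : ℝ => fderiv ℝ f (Real.cos s • x + Real.sin s • y)
        (-Real.sin s • x + Real.cos s • y) := by fun_prop
    have hint := intervalIntegral.integral_eq_sub_of_hasDerivAt (fun s _ => hd s)
      (hcont.intervalIntegrable 0 θ)
    simp only [Real.cos_zero, Real.sin_zero, one_smul, zero_smul, add_zero] at hint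
    rw [enorm_sub_rev, ← hint, intervalIntegral.integral_of_le hθ]
    exact enorm_integral_le_lintegral_enorm _
  have hmeas : Measurable fun p : E × E => ‖fderiv ℝ f p.1 p.2‖ₑ := by
    have : Continuous fun p : E × E => fderiv ℝ f p.1 p.2 := by fun_prop
    exact this.measurable.enorm
  have hmeas3 : Measurable fun q : (E × E) × ℝ =>
      ‖fderiv ℝ f (Real.cos q.2 • q.1.1 + Real.sin q.2 • q.1.2)
        (-Real.sin q.2 • q.1.1 + Real.cos q.2 • q.1.2)‖ₑ := by
    have : Continuous fun q : (E × E) × ℝ =>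
      fderiv ℝ f (Real.cos q.2 • q.1.1 + Real.sin q.2 • q.1.2)
        (-Real.sin q.2 • q.1.1 + Real.cos q.2 • q.1.2) := by fun_prop
    exact this.measurable.enorm
  have hrot : ∀ s : ℝ, ∫⁻ p : E × E, ‖fderiv ℝ f (Real.cos s • p.1 + Real.sin s • p.2)
        (-Real.sin s • p.1 + Real.cos s • p.2)‖ₑ ∂(μ.prod μ) =
      ∫⁻ p : E × E, ‖fderiv ℝ f p.1 p.2‖ₑ ∂(μ.prod μ) := by
    intro s
    have h := IsGaussian.map_rotation_eq_self (μ := μ) (by simp [hμ]) s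
    conv_rhs => rw [← h]
    rw [lintegral_map hmeas (ContinuousLinearMap.continuous _).measurable]
    simp only [ContinuousLinearMap.rotation_apply]
  have hmeas2 : Measurable fun p : E × E => ‖f p.1 - f (Real.cos θ • p.1 + Real.sin θ • p.2)‖ₑ := by
    have : Continuous fun p : E × E => f p.1 - f (Real.cos θ • p.1 + Real.sin θ • p.2) := by
      fun_prop
    exact this.measurable.enorm
  calc
    _ = ∫⁻ p : E × E, ‖f p.1 - f (Real.cos θ • p.1 + Real.sin θ • p.2)‖ₑ ∂(μ.prod μ) :=
      (lintegral_prod _ hmeas2.aemeasurable).symm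
    _ ≤ ∫⁻ p : E × E, (∫⁻ s in Set.Ioc 0 θ,
          ‖fderiv ℝ f (Real.cos s • p.1 + Real.sin s • p.2)
            (-Real.sin s • p.1 + Real.cos s • p.2)‖ₑ) ∂(μ.prod μ) :=
      lintegral_mono fun p => hpath p.1 p.2
    _ = ∫⁻ s in Set.Ioc 0 θ, ∫⁻ p : E × E,
          ‖fderiv ℝ f (Real.cos s • p.1 + Real.sin s • p.2)
            (-Real.sin s • p.1 + Real.cos s • p.2)‖ₑ ∂(μ.prod μ) :=
      lintegral_lintegral_swap hmeas3.aemeasurable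
    _ = ENNReal.ofReal θ * ∫⁻ p : E × E, ‖fderiv ℝ f p.1 p.2‖ₑ ∂(μ.prod μ) := by
      simp_rw [hrot]
      rw [setLIntegral_const, Real.volume_Ioc, sub_zero, mul_comm]
    _ = ENNReal.ofReal θ * ∫⁻ x, ∫⁻ y, ‖fderiv ℝ f x y‖ₑ ∂μ ∂μ := by
      rw [lintegral_prod _ hmeas.aemeasurable]
    _ ≤ _ := by
      gcongr with x
      exact lintegral_enorm_dual_stdGaussian_le _

/-- `L¹` closeness of `f` and `Q_t f`. -/
theorem ou_L1_closeness {n : ℕ} (f : En n → ℝ)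
    (hf : ContDiff ℝ 1 f) (Mf : ℝ) (hMf : ∀ x, |f x| ≤ Mf)
    (Md : ℝ) (hMd : ∀ x, ‖fderiv ℝ f x‖ ≤ Md)
    (t : ℝ) (ht : 0 ≤ t) :
    ∫ x, |f x - ou n t f x| ∂(gaussE n) ≤
      Real.sqrt (2 * t) * ∫ x, ‖gradient f x‖ ∂(gaussE n) := by
  have hfc : Continuous f := hf.continuous
  have hf' : Continuous (fderiv ℝ f) := hf.continuous_fderiv one_ne_zero
  have hgrad : ∀ x, ‖gradient f x‖ = ‖fderiv ℝ f x‖ := fun x => by simp [gradient]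
  have he1 : Real.exp (-t) ≤ 1 := Real.exp_le_one_iff.2 (by linarith)
  set θ := Real.arccos (Real.exp (-t)) with hθ
  have hcos : Real.cos θ = Real.exp (-t) :=
    Real.cos_arccos (by linarith [Real.exp_pos (-t)]) he1
  have hsin : Real.sin θ = Real.sqrt (1 - Real.exp (-2 * t)) := by
    rw [hθ, Real.sin_arccos, ← Real.exp_nat_mul]
    congr 3
    push_cast
    ring
  have hou : ∀ x, ou n t f x = ∫ y, f (Real.cos θ • x + Real.sin θ • y) ∂(stdGaussian (En n)) :=
    fun x => by rw [ou, hcos, hsin, gaussE_eq_stdGaussian]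
  have hfint : ∀ x : En n, Integrable (fun y => f (Real.cos θ • x + Real.sin θ • y))
      (stdGaussian (En n)) := fun x =>
    Integrable.of_bound (by fun_prop) Mf (.of_forall fun y => hMf _)
  have hpt : ∀ x, ‖f x - ou n t f x‖ₑ ≤
      ∫⁻ y, ‖f x - f (Real.cos θ • x + Real.sin θ • y)‖ₑ ∂(stdGaussian (En n)) := by
    intro x
    have h : f x - ou n t f x =
        ∫ y, (f x - f (Real.cos θ • x + Real.sin θ • y)) ∂(stdGaussian (En n)) := by
      rw [integral_sub (integrable_const _) (hfint x), hou]
      simp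
    rw [h]
    exact enorm_integral_le_lintegral_enorm _
  have hdint : Integrable (fun x => fderiv ℝ f x) (stdGaussian (En n)) :=
    Integrable.of_bound hf'.aestronglyMeasurable Md (.of_forall hMd)
  have key : ∫⁻ x, ‖f x - ou n t f x‖ₑ ∂(stdGaussian (En n)) ≤
      ENNReal.ofReal (θ * ∫ x, ‖fderiv ℝ f x‖ ∂(stdGaussian (En n))) := by
    rw [ENNReal.ofReal_mul (Real.arccos_nonneg _), ofReal_integral_norm_eq_lintegral_enorm hdint]
    exact (lintegral_mono hpt).trans (lintegral_enorm_sub_rotation_le hf (Real.arccos_nonneg _))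
  have houm : StronglyMeasurable (ou n t f) := by
    have h : Continuous fun p : En n × En n => f (Real.cos θ • p.1 + Real.sin θ • p.2) := by
      fun_prop
    have h2 := h.stronglyMeasurable.integral_prod_right' (ν := stdGaussian (En n))
    rwa [show ou n t f = _ from funext hou]
  simp_rw [gaussE_eq_stdGaussian, hgrad]
  have hnn : 0 ≤ ∫ x, ‖fderiv ℝ f x‖ ∂(stdGaussian (En n)) :=
    integral_nonneg fun x => norm_nonneg _
  calc
    _ = (∫⁻ x, ‖f x - ou n t f x‖ₑ ∂(stdGaussian (En n))).toReal := by
      simp_rw [← Real.norm_eq_abs]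
      exact integral_norm_eq_lintegral_enorm
        (hfc.stronglyMeasurable.sub houm).aestronglyMeasurable
    _ ≤ θ * ∫ x, ‖fderiv ℝ f x‖ ∂(stdGaussian (En n)) :=
      ENNReal.toReal_le_of_le_ofReal (mul_nonneg (Real.arccos_nonneg _) hnn) key
    _ ≤ _ := mul_le_mul_of_nonneg_right (arccos_exp_neg_le_sqrt ht) hnn
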